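/- There exist uncountable classes of value-stable environments for which there is no self-optimizing policy. Specifically, the class of all deterministic passive sequence-prediction environments (in which the agent predicts the next binary observation and receives reward 1 for a correct prediction and 0 otherwise) is uncountable, every environment in it is value-stable (with d ≡ 1, φ ≡ 0, r_i ≡ 1), and for every policy p there is an environment in this class on which p receives reward 0 at every step, so no self-optimizing policy for this class exists. -/

import Mathlib

open MeasureTheory Filter Finset Asymptotics
open scoped ENNReal Classical

noncomputable section

namespace RL

/-- A perception `x = (r, o)`: a reward `r ∈ R = {0, …, r_max}` together with an
observation `o ∈ O`. -/
abbrev Percept (O : Type) (rmax : ℕ) := Fin (rmax + 1) × O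

/-- A cycle `z = (y, r, o)`: an action together with the resulting perception. -/
abbrev Cycle (Y O : Type) (rmax : ℕ) := Y × Percept O rmax

/-- A deterministic policy maps a history `z_{<k}` to the next action `y_k`. -/
abbrev Policy (Y O : Type) (rmax : ℕ) := List (Cycle Y O rmax) → Y

/-- An infinite interaction sequence. -/
abbrev Traj (Y O : Type) (rmax : ℕ) := ℕ → Cycle Y O rmax

instance (Y O : Type) (rmax : ℕ) : MeasurableSpace (Cycle Y O rmax) := ⊤

/-- The reward of a cycle `z = (y, (r, o))`, as a real number. -/
def rew {Y O : Type} {rmax : ℕ} (z : Cycle Y O rmax) : ℝ := ((z.2.1 : ℕ) : ℝ)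

/-- The cylinder set of all infinite sequences extending the finite sequence `l`. -/
def cylSet {A : Type} (l : List A) : Set (ℕ → A) := {ω | ∀ i : Fin l.length, ω i.1 = l.get i}

/-- An environment: conditional probabilities `ν(x_k | z_{<k} y_k)` of the next perception
given the history, together with, for each (deterministic) policy `p`, the induced
probability measure on interaction sequences, which on cylinder sets is given by the
product of the conditional probabilities (actions being forced by the policy). -/
structure Environment (Y O : Type) [Fintype Y] [Fintype O] (rmax : ℕ) where
  cond : List (Cycle Y O rmax) → Y → Percept O rmax → ℝ
  cond_nonneg : ∀ h y x, 0 ≤ cond h y x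
  cond_sum_one : ∀ h y, ∑ x : Percept O rmax, cond h y x = 1
  P : Policy Y O rmax → Measure (Traj Y O rmax)
  P_prob : ∀ p, IsProbabilityMeasure (P p)
  P_cyl : ∀ (p : Policy Y O rmax) (h : List (Cycle Y O rmax)) (z : Cycle Y O rmax),
    P p (cylSet (h ++ [z]))
      = P p (cylSet h) * ENNReal.ofReal (if z.1 = p h then cond h z.1 z.2 else 0)

variable {Y O : Type} [Fintype Y] [Fintype O] {rmax : ℕ}

/-- The average reward `(1/m) r_{1..m}` of the first `m` steps of a trajectory. -/
def avg {Y O : Type} {rmax : ℕ} (ω : Traj Y O rmax) (m : ℕ) : ℝ :=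
  (∑ i ∈ Finset.range m, rew (ω i)) / m

/-- `V(ν,p) = V` : the average limiting value exists a.s. and equals the constant `V`. -/
def ValueIs (ν : Environment Y O rmax) (p : Policy Y O rmax) (V : ℝ) : Prop :=
  ν.P p {ω | Tendsto (avg ω) atTop (nhds V)} = 1

/-- `V̄(ν,p) = V` : the upper limiting average value is a.s. the constant `V`. -/
def UpperValueIs (ν : Environment Y O rmax) (p : Policy Y O rmax) (V : ℝ) : Prop :=
  ν.P p {ω | limsup (avg ω) atTop = V} = 1

/-- `V` is the optimal value `V*_ν` of `ν`: some policy `p_ν` achieves average value `V`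
a.s., and every policy has upper average value `≤ V` a.s. -/
def IsOptimalValue (ν : Environment Y O rmax) (V : ℝ) : Prop :=
  ∃ p, ValueIs ν p V ∧ ∀ q : Policy Y O rmax, ν.P q {ω | limsup (avg ω) atTop ≤ V} = 1

/-- An environment is explorable if it has an optimal value `V*_ν`. -/
def Explorable (ν : Environment Y O rmax) : Prop := ∃ V, IsOptimalValue ν V

/-- `V` is the upper optimal value `V̄*_ν` of `ν`. -/
def IsUpperOptimalValue (ν : Environment Y O rmax) (V : ℝ) : Prop :=
  ∃ p, UpperValueIs ν p V ∧ ∀ q : Policy Y O rmax, ν.P q {ω | limsup (avg ω) atTop ≤ V} = 1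

/-- An environment is upper explorable if it has an upper optimal value `V̄*_ν`. -/
def UpperExplorable (ν : Environment Y O rmax) : Prop := ∃ V, IsUpperOptimalValue ν V

/-- `ν(x_{<k} | y_{<k})` : the probability of the perceptions of the history `h`,
given its actions. -/
def histProbX (ν : Environment Y O rmax) (h : List (Cycle Y O rmax)) : ℝ :=
  ∏ i : Fin h.length, ν.cond (h.take i.1) (h.get i).1 (h.get i).2

/-- Replace the first `k-1` actions of the policy `p` by the actions `y_{<k}` of the
history `h`. -/
def replacePolicy (h : List (Cycle Y O rmax)) (p : Policy Y O rmax) : Policy Y O rmax :=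
  fun l => if hl : l.length < h.length then (h.get ⟨l.length, hl⟩).1 else p l

/-- The measure induced by `(p, ν)` conditional on the history `h = z_{<k}`:
`ν`-probabilities conditional on `x_{<k}`, with the first `k-1` actions of `p`
replaced by `y_{<k}`. -/
def condMeasure (ν : Environment Y O rmax) (p : Policy Y O rmax)
    (h : List (Cycle Y O rmax)) : Measure (Traj Y O rmax) :=
  ProbabilityTheory.cond (ν.P (replacePolicy h p)) (cylSet h)

/-- `P( · | z_{<k})` under policy `p` in environment `ν`. -/
def condProb (ν : Environment Y O rmax) (p : Policy Y O rmax)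
    (h : List (Cycle Y O rmax)) (A : Set (Traj Y O rmax)) : ℝ≥0∞ :=
  condMeasure ν p h A

/-- `V(ν,p,z_{<k}) = V` : conditional on `z_{<k}`, the average limiting value is a.s. `V`. -/
def CondValueIs (ν : Environment Y O rmax) (p : Policy Y O rmax)
    (h : List (Cycle Y O rmax)) (V : ℝ) : Prop :=
  condProb ν p h {ω | Tendsto (avg ω) atTop (nhds V)} = 1

/-- `V̄(ν,p,z_{<k}) = V` : conditional on `z_{<k}`, the upper limiting average value
is a.s. `V`. -/
def CondUpperValueIs (ν : Environment Y O rmax) (p : Policy Y O rmax)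
    (h : List (Cycle Y O rmax)) (V : ℝ) : Prop :=
  condProb ν p h {ω | limsup (avg ω) atTop = V} = 1

/-- `V` is the conditional optimal value `V*_ν(z_{<k})`. -/
def IsCondOptimalValue (ν : Environment Y O rmax) (h : List (Cycle Y O rmax)) (V : ℝ) : Prop :=
  ∃ p, CondValueIs ν p h V ∧
    ∀ q : Policy Y O rmax, condProb ν q h {ω | limsup (avg ω) atTop ≤ V} = 1

/-- `V` is the conditional upper optimal value `V̄*_ν(z_{<k})`. -/
def IsCondUpperOptimalValue (ν : Environment Y O rmax) (h : List (Cycle Y O rmax)) (V : ℝ) :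
    Prop :=
  ∃ p, CondUpperValueIs ν p h V ∧
    ∀ q : Policy Y O rmax, condProb ν q h {ω | limsup (avg ω) atTop ≤ V} = 1

/-- Strongly explorable: after any history of positive probability there is a conditionally
optimal value. -/
def StronglyExplorable (ν : Environment Y O rmax) : Prop :=
  ∀ h, 0 < histProbX ν h → ∃ V, IsCondOptimalValue ν h V

/-- Strongly upper explorable. -/
def StronglyUpperExplorable (ν : Environment Y O rmax) : Prop :=
  ∀ h, 0 < histProbX ν h → ∃ V, IsCondUpperOptimalValue ν h V

/-- The worst-case optimal value `W*_ν = inf_{z_{<k}} V*_ν(z_{<k})`. -/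
def Wstar (ν : Environment Y O rmax) : ℝ :=
  sInf {V | ∃ h, 0 < histProbX ν h ∧ IsCondOptimalValue ν h V}

/-- The worst-case upper optimal value `W̄*_ν = inf_{z_{<k}} V̄*_ν(z_{<k})`. -/
def WstarUpper (ν : Environment Y O rmax) : ℝ :=
  sInf {V | ∃ h, 0 < histProbX ν h ∧ IsCondUpperOptimalValue ν h V}

/-- Recoverable: after any history of positive probability, some policy attains the
upper optimal value `V̄*_ν` with conditional probability 1. -/
def Recoverable (ν : Environment Y O rmax) : Prop :=
  ∃ V, IsUpperOptimalValue ν V ∧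
    ∀ h, 0 < histProbX ν h →
      ∃ p, condProb ν p h {ω | limsup (avg ω) atTop = V} = 1

/-- The quantitative part of value-stability, with target value `W`:
rewards `r_i ∈ [0, r_max]` with `(1/n) r_{1..n} → W`, `d(k,ε) = o(k)`,
`Σ_n φ(n,ε) < ∞`, and from any history `z_{<k}` some policy `p` recovers:
`P( r_{k..k+n} − r^{pν}_{k..k+n} > d(k,ε) + nε | z_{<k} ) ≤ φ(n,ε)`. -/
def ValueStableCore (ν : Environment Y O rmax) (W : ℝ) (r : ℕ → ℝ)
    (d : ℕ → ℝ → ℝ) (φ : ℕ → ℝ → ℝ) : Prop :=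
  (∀ i, r i ∈ Set.Icc (0 : ℝ) (rmax : ℝ)) ∧
  Tendsto (fun n => (∑ i ∈ Finset.range n, r i) / n) atTop (nhds W) ∧
  (∀ ε : ℝ, 0 < ε → (fun k : ℕ => d k ε) =o[atTop] fun k : ℕ => (k : ℝ)) ∧
  (∀ ε : ℝ, 0 < ε → Summable fun n => φ n ε) ∧
  ∀ h : List (Cycle Y O rmax), ∃ p : Policy Y O rmax, ∀ ε : ℝ, 0 < ε → ∀ n : ℕ,
    condProb ν p h
      {ω | d h.length ε + n * ε <
        (∑ i ∈ Finset.Icc h.length (h.length + n), r i)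
          - ∑ i ∈ Finset.Icc h.length (h.length + n), rew (ω i)}
      ≤ ENNReal.ofReal (φ n ε)

/-- Value-stability with explicit witnesses `V = V*_ν`, `r`, `d`, `φ`. -/
def ValueStableWith (ν : Environment Y O rmax) (V : ℝ) (r : ℕ → ℝ)
    (d : ℕ → ℝ → ℝ) (φ : ℕ → ℝ → ℝ) : Prop :=
  IsOptimalValue ν V ∧ ValueStableCore ν V r d φ

/-- A value-stable environment. -/
def ValueStable (ν : Environment Y O rmax) : Prop :=
  ∃ V r d φ, ValueStableWith ν V r d φ

/-- A worst-case value-stable environment: strongly explorable, and the value-stability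
condition holds with target `W*_ν`. -/
def WorstCaseValueStable (ν : Environment Y O rmax) : Prop :=
  StronglyExplorable ν ∧ ∃ r d φ, ValueStableCore ν (Wstar ν) r d φ

/-- A policy is self-optimizing for a class `C` if it attains the optimal value `V*_ν`
in every `ν ∈ C`. -/
def SelfOptimizing (p : Policy Y O rmax) (C : Set (Environment Y O rmax)) : Prop :=
  ∀ ν ∈ C, ∀ V, IsOptimalValue ν V → ValueIs ν p V

/-- A policy is upper self-optimizing for a class `C` if it attains the upper optimal
value `V̄*_ν` in every `ν ∈ C`. -/
def UpperSelfOptimizing (p : Policy Y O rmax) (C : Set (Environment Y O rmax)) : Prop :=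
  ∀ ν ∈ C, ∀ V, IsUpperOptimalValue ν V → UpperValueIs ν p V

/-- A deterministic environment: all conditional probabilities are `0` or `1`. -/
def Deterministic (ν : Environment Y O rmax) : Prop :=
  ∀ h y x, ν.cond h y x = 0 ∨ ν.cond h y x = 1

/-- In a deterministic environment, the perception following history `h` and action `y`. -/
def pick [Nonempty O] (ν : Environment Y O rmax) (h : List (Cycle Y O rmax)) (y : Y) :
    Percept O rmax :=
  if hx : ∃ x, ν.cond h y x = 1 then hx.choose else Classical.arbitrary _

/-- The (deterministic) history generated by policy `p` in a deterministic environment. -/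
def detHist [Nonempty O] (ν : Environment Y O rmax) (p : Policy Y O rmax) :
    ℕ → List (Cycle Y O rmax)
  | 0 => []
  | n + 1 =>
      detHist ν p n ++ [(p (detHist ν p n), pick ν (detHist ν p n) (p (detHist ν p n)))]

/-- The cycle `z_n` generated by policy `p` in a deterministic environment. -/
def detZ [Nonempty O] (ν : Environment Y O rmax) (p : Policy Y O rmax) (n : ℕ) :
    Cycle Y O rmax :=
  (p (detHist ν p n), pick ν (detHist ν p n) (p (detHist ν p n)))

end RL

namespace RL

/-- The deterministic passive sequence-prediction environment determined by the infinite
binary sequence `a` of observations: the action `y_i` is a prediction of the next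
observation `o_{i+1}`, the observation revealed at step `i` is `a i`, and the reward is
`1` if the prediction is correct and `0` otherwise (observations do not depend on
actions). -/
def IsSeqPredDet (ν : Environment Bool Bool 1) (a : ℕ → Bool) : Prop :=
  ∀ h y x, ν.cond h y x =
    if x = ((if y = a (h.length + 1) then 1 else 0 : Fin 2), a h.length) then 1 else 0

section Play

variable {Y O : Type} {rmax : ℕ}

/-- The history of length `n` generated by the policy `p` against the deterministic
response function `f`. -/
def playHist (f : List (Cycle Y O rmax) → Y → Percept O rmax) (p : Policy Y O rmax) :
    ℕ → List (Cycle Y O rmax)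
  | 0 => []
  | n + 1 => playHist f p n ++ [(p (playHist f p n), f (playHist f p n) (p (playHist f p n)))]

/-- The trajectory generated by the policy `p` against the response function `f`. -/
def play (f : List (Cycle Y O rmax) → Y → Percept O rmax) (p : Policy Y O rmax) :
    Traj Y O rmax :=
  fun n => (p (playHist f p n), f (playHist f p n) (p (playHist f p n)))

theorem length_playHist (f : List (Cycle Y O rmax) → Y → Percept O rmax)
    (p : Policy Y O rmax) (n : ℕ) : (playHist f p n).length = n := by
  induction n with
  | zero => rfl
  | succ n ih => simp [playHist, ih]

theorem map_play_range (f : List (Cycle Y O rmax) → Y → Percept O rmax)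
    (p : Policy Y O rmax) (n : ℕ) : (List.range n).map (play f p) = playHist f p n := by
  induction n with
  | zero => rfl
  | succ n ih => rw [List.range_succ, List.map_append, ih]; rfl

theorem mem_cylSet_iff {A : Type} {l : List A} {ω : ℕ → A} :
    ω ∈ cylSet l ↔ (List.range l.length).map ω = l := by
  constructor
  · intro h
    refine List.ext_getElem (by simp) fun i h₁ h₂ => ?_
    simpa using h ⟨i, h₂⟩
  · intro h i
    have := List.getElem_of_eq h (i := i.1) (by simp)
    simpa using this

theorem mem_cylSet_append_singleton {A : Type} {l : List A} {z : A} {ω : ℕ → A} :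
    ω ∈ cylSet (l ++ [z]) ↔ ω ∈ cylSet l ∧ ω l.length = z := by
  simp only [mem_cylSet_iff, List.length_append, List.length_singleton, List.range_succ,
    List.map_append, List.map_singleton]
  constructor
  · intro h
    obtain ⟨h₁, h₂⟩ := List.append_inj h (by simp)
    exact ⟨h₁, by simpa using h₂⟩
  · rintro ⟨h₁, h₂⟩
    rw [h₁, h₂]

theorem play_mem_cylSet_iff {f : List (Cycle Y O rmax) → Y → Percept O rmax}
    {p : Policy Y O rmax} {l : List (Cycle Y O rmax)} :
    play f p ∈ cylSet l ↔ playHist f p l.length = l := by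
  rw [mem_cylSet_iff, map_play_range]

theorem measurableSet_cylSet (l : List (Cycle Y O rmax)) :
    MeasurableSet (cylSet l : Set (Traj Y O rmax)) := by
  have : (cylSet l : Set (Traj Y O rmax)) =
      ⋂ i : Fin l.length, (fun ω : Traj Y O rmax => ω i.1) ⁻¹' {l.get i} := by
    ext ω; simp [cylSet]
  rw [this]
  exact MeasurableSet.iInter fun i => measurable_pi_apply i.1 MeasurableSpace.measurableSet_top

variable [Fintype Y] [Fintype O]

/-- The environment answering with the deterministic response function `f`. -/
def ofResponse (f : List (Cycle Y O rmax) → Y → Percept O rmax) : Environment Y O rmax where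
  cond h y x := if x = f h y then 1 else 0
  cond_nonneg h y x := by split_ifs <;> norm_num
  cond_sum_one h y := by simp
  P p := Measure.dirac (play f p)
  P_prob p := inferInstance
  P_cyl p h z := by
    rw [Measure.dirac_apply' _ (measurableSet_cylSet _),
      Measure.dirac_apply' _ (measurableSet_cylSet _)]
    by_cases hh : play f p ∈ cylSet h
    · have hl : play f p h.length = (p h, f h (p h)) := by
        simp only [play, play_mem_cylSet_iff.1 hh]
      by_cases hz : z = (p h, f h (p h))
      · have : play f p ∈ cylSet (h ++ [z]) :=
          mem_cylSet_append_singleton.2 ⟨hh, hl.trans hz.symm⟩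
        rw [Set.indicator_of_mem this, Set.indicator_of_mem hh, hz]
        simp
      · have : play f p ∉ cylSet (h ++ [z]) := fun hm =>
          hz ((mem_cylSet_append_singleton.1 hm).2.symm.trans hl)
        obtain ⟨y, x⟩ := z
        by_cases hy : y = p h
        · subst hy
          have hx : x ≠ f h (p h) := fun hx => hz (by rw [hx])
          simp [this, hx]
        · simp [this, hy]
    · have : play f p ∉ cylSet (h ++ [z]) := fun hm => hh (mem_cylSet_append_singleton.1 hm).1
      simp [hh, this]

/-- The perceptions of `ν` are given deterministically by the response function `f`. -/
def RespondsWith (ν : Environment Y O rmax)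
    (f : List (Cycle Y O rmax) → Y → Percept O rmax) : Prop :=
  ∀ h y x, ν.cond h y x = if x = f h y then 1 else 0

variable {ν : Environment Y O rmax} {f : List (Cycle Y O rmax) → Y → Percept O rmax}

theorem RespondsWith.pick_eq [Nonempty O] (hν : RespondsWith ν f)
    (h : List (Cycle Y O rmax)) (y : Y) : pick ν h y = f h y := by
  have hx : ∃ x, ν.cond h y x = 1 := ⟨f h y, by simp [hν h y]⟩
  have hc := hx.choose_spec
  rw [pick, dif_pos hx]
  by_contra hne
  rw [hν, if_neg hne] at hc
  exact zero_ne_one hc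

theorem RespondsWith.detHist_eq [Nonempty O] (hν : RespondsWith ν f) (p : Policy Y O rmax)
    (n : ℕ) : detHist ν p n = playHist f p n := by
  induction n with
  | zero => rfl
  | succ n ih => simp only [detHist, playHist, ih, hν.pick_eq]

theorem RespondsWith.detZ_eq [Nonempty O] (hν : RespondsWith ν f) (p : Policy Y O rmax)
    (n : ℕ) : detZ ν p n = play f p n := by
  simp only [detZ, play, hν.detHist_eq, hν.pick_eq]

theorem RespondsWith.measure_cylSet_playHist (hν : RespondsWith ν f) (p : Policy Y O rmax)
    (n : ℕ) : ν.P p (cylSet (playHist f p n)) = 1 := by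
  have := ν.P_prob p
  induction n with
  | zero =>
    have : (cylSet (playHist f p 0) : Set (Traj Y O rmax)) = Set.univ :=
      Set.eq_univ_of_forall fun ω => mem_cylSet_iff.2 rfl
    rw [this, measure_univ]
  | succ n ih => simp [playHist, ν.P_cyl, ih, hν _ _ _]

theorem RespondsWith.ae_eq_play (hν : RespondsWith ν f) (p : Policy Y O rmax) :
    ∀ᵐ ω ∂ν.P p, ω = play f p := by
  have := ν.P_prob p
  have hall : ∀ᵐ ω ∂ν.P p, ∀ n, ω ∈ cylSet (playHist f p n) :=
    ae_all_iff.2 fun n => (mem_ae_iff_prob_eq_one (measurableSet_cylSet _)).2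
      (hν.measure_cylSet_playHist p n)
  filter_upwards [hall] with ω hω
  funext n
  have := (mem_cylSet_append_singleton.1 (hω (n + 1))).2
  rwa [length_playHist] at this

theorem measure_eq_one_of_ae {p : Policy Y O rmax} {S : Set (Traj Y O rmax)}
    (hS : ∀ᵐ ω ∂ν.P p, ω ∈ S) : ν.P p S = 1 := by
  have := ν.P_prob p
  exact (measure_congr (eventuallyEq_univ.2 hS)).trans measure_univ

theorem RespondsWith.valueIs_iff (hν : RespondsWith ν f) (p : Policy Y O rmax) (V : ℝ) :
    ValueIs ν p V ↔ Tendsto (avg (play f p)) atTop (nhds V) := by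
  constructor
  · intro h
    by_contra hne
    have h0 : ν.P p {ω | Tendsto (avg ω) atTop (nhds V)} = 0 := by
      refine measure_eq_zero_iff_ae_notMem.2 ?_
      filter_upwards [hν.ae_eq_play p] with ω hω
      rw [hω]
      exact hne
    rw [ValueIs, h0] at h
    exact zero_ne_one h
  · intro h
    refine measure_eq_one_of_ae ?_
    filter_upwards [hν.ae_eq_play p] with ω hω
    rw [hω]
    exact h

end Play

theorem rew_nonneg {Y O : Type} {rmax : ℕ} (z : Cycle Y O rmax) : 0 ≤ rew z :=
  Nat.cast_nonneg _

theorem rew_le {Y O : Type} {rmax : ℕ} (z : Cycle Y O rmax) : rew z ≤ rmax :=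
  Nat.cast_le.2 (Nat.lt_succ_iff.1 z.2.1.2)

theorem limsup_avg_le {Y O : Type} {rmax : ℕ} (ω : Traj Y O rmax) :
    limsup (avg ω) atTop ≤ rmax := by
  refine limsup_le_of_le ?_ (Eventually.of_forall fun m => ?_)
  · refine IsBoundedUnder.isCoboundedUnder_le ⟨0, ?_⟩
    exact eventually_map.2 (Eventually.of_forall fun m =>
      div_nonneg (Finset.sum_nonneg fun i _ => rew_nonneg _) (Nat.cast_nonneg _))
  · refine div_le_of_le_mul₀ (Nat.cast_nonneg _) (Nat.cast_nonneg _) ?_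
    calc ∑ i ∈ Finset.range m, rew (ω i) ≤ ∑ _i ∈ Finset.range m, (rmax : ℝ) :=
          Finset.sum_le_sum fun i _ => rew_le _
      _ = rmax * m := by simp [mul_comm]

theorem tendsto_sum_one_div :
    Tendsto (fun n : ℕ => (∑ _i ∈ Finset.range n, (1 : ℝ)) / n) atTop (nhds 1) := by
  refine tendsto_const_nhds.congr' ?_
  filter_upwards [eventually_gt_atTop 0] with n hn
  simp [hn.ne']

/-- The response function of the sequence-prediction environment of the sequence `a`. -/
def seqResponse (a : ℕ → Bool) (h : List (Cycle Bool Bool 1)) (y : Bool) : Percept Bool 1 :=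
  (if y = a (h.length + 1) then 1 else 0, a h.length)

theorem IsSeqPredDet.respondsWith {ν : Environment Bool Bool 1} {a : ℕ → Bool}
    (hν : IsSeqPredDet ν a) : RespondsWith ν (seqResponse a) := by
  intro h y x
  rw [hν h y x]
  by_cases hx : x = seqResponse a h y
  · exact (if_pos hx).trans (if_pos hx).symm
  · exact (if_neg hx).trans (if_neg hx).symm

theorem isSeqPredDet_ofResponse (a : ℕ → Bool) :
    IsSeqPredDet (ofResponse (seqResponse a)) a := by
  intro h y x
  exact ite_congr rfl (fun _ => rfl) fun _ => rfl

theorem IsSeqPredDet.unique {ν : Environment Bool Bool 1} {a b : ℕ → Bool}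
    (ha : IsSeqPredDet ν a) (hb : IsSeqPredDet ν b) : a = b := by
  funext n
  have h := (ha.respondsWith.pick_eq (List.replicate n (false, 0, false)) false).symm.trans
    (hb.respondsWith.pick_eq _ _)
  simpa [seqResponse] using congrArg Prod.snd h

theorem not_countable_isSeqPredDet :
    ¬ {ν : Environment Bool Bool 1 | ∃ a, IsSeqPredDet ν a}.Countable := by
  intro hC
  have hinj : Function.Injective
      fun a : ℕ → Bool => (⟨ofResponse (seqResponse a), a, isSeqPredDet_ofResponse a⟩ :
        {ν : Environment Bool Bool 1 | ∃ a, IsSeqPredDet ν a}) := by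
    intro a b hab
    have hab' : ofResponse (seqResponse a) = ofResponse (seqResponse b) := congrArg Subtype.val hab
    exact (isSeqPredDet_ofResponse a).unique (hab' ▸ isSeqPredDet_ofResponse b)
  have := hC.to_subtype
  have hc : Countable (ℕ → Bool) := hinj.countable
  obtain ⟨g, hg⟩ := exists_surjective_nat (ℕ → Bool)
  obtain ⟨n, hn⟩ := hg fun n => !g n n
  simpa using congrFun hn n

/-- The policy which knows the sequence `a` and always predicts correctly. -/
def informedPolicy (a : ℕ → Bool) : Policy Bool Bool 1 := fun h => a (h.length + 1)

theorem rew_play_seqResponse (a : ℕ → Bool) (p : Policy Bool Bool 1) (n : ℕ) :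
    rew (play (seqResponse a) p n) =
      if p (playHist (seqResponse a) p n) = a (n + 1) then 1 else 0 := by
  simp only [rew, play, seqResponse, length_playHist]
  split_ifs <;> simp

theorem isOptimalValue_one {ν : Environment Bool Bool 1} {a : ℕ → Bool}
    (hν : IsSeqPredDet ν a) : IsOptimalValue ν 1 := by
  refine ⟨informedPolicy a, (hν.respondsWith.valueIs_iff _ _).2 ?_, fun q => ?_⟩
  · refine tendsto_sum_one_div.congr fun n => ?_
    simp [avg, rew_play_seqResponse, informedPolicy, length_playHist]
  · refine measure_eq_one_of_ae (Eventually.of_forall fun ω => ?_)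
    simpa using limsup_avg_le ω

theorem valueStableWith_one {ν : Environment Bool Bool 1} {a : ℕ → Bool}
    (hν : IsSeqPredDet ν a) :
    ValueStableWith ν 1 (fun _ => 1) (fun _ _ => 1) (fun _ _ => 0) := by
  refine ⟨isOptimalValue_one hν, fun i => by simp, tendsto_sum_one_div, fun ε _ => ?_,
    fun ε _ => summable_zero, fun h => ⟨informedPolicy a, fun ε hε n => ?_⟩⟩
  · exact (isLittleO_const_left.2 (Or.inr
      (tendsto_norm_atTop_atTop.comp tendsto_natCast_atTop_atTop)))
  · rw [ENNReal.ofReal_zero, nonpos_iff_eq_zero]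
    refine ProbabilityTheory.cond_absolutelyContinuous (measure_eq_zero_iff_ae_notMem.2 ?_)
    filter_upwards [hν.respondsWith.ae_eq_play (replacePolicy h (informedPolicy a))] with ω hω
    have hr : ∀ i ∈ Finset.Icc h.length (h.length + n), rew (ω i) = 1 := by
      intro i hi
      have hi' : ¬ i < h.length := not_lt.2 (Finset.mem_Icc.1 hi).1
      rw [hω, rew_play_seqResponse, if_pos]
      simp [replacePolicy, length_playHist, hi', informedPolicy]
    rw [Finset.sum_congr rfl hr, sub_self, not_lt]
    positivity

/-- Histories, paired with the next observation, when every prediction of `p` is wrong. -/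
def adversary (p : Policy Bool Bool 1) : ℕ → List (Cycle Bool Bool 1) × Bool
  | 0 => ([], false)
  | n + 1 => ((adversary p n).1 ++ [(p (adversary p n).1, 0, (adversary p n).2)],
      !p (adversary p n).1)

theorem playHist_adversary (p : Policy Bool Bool 1) (n : ℕ) :
    playHist (seqResponse fun k => (adversary p k).2) p n = (adversary p n).1 := by
  induction n with
  | zero => rfl
  | succ n ih =>
    have hl := length_playHist (seqResponse fun k => (adversary p k).2) p n
    rw [ih] at hl
    simp [playHist, ih, seqResponse, hl, adversary]

theorem rew_play_adversary (p : Policy Bool Bool 1) (n : ℕ) :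
    rew (play (seqResponse fun k => (adversary p k).2) p n) = 0 := by
  rw [rew_play_seqResponse, playHist_adversary]
  simp [adversary]

theorem exists_isSeqPredDet_rew_eq_zero (p : Policy Bool Bool 1) :
    ∃ ν ∈ {ν : Environment Bool Bool 1 | ∃ a, IsSeqPredDet ν a}, ∀ i, rew (detZ ν p i) = 0 := by
  have h := isSeqPredDet_ofResponse fun k => (adversary p k).2
  refine ⟨_, ⟨_, h⟩, fun i => ?_⟩
  rw [h.respondsWith.detZ_eq]
  exact rew_play_adversary p i

theorem not_selfOptimizing (p : Policy Bool Bool 1) :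
    ¬ SelfOptimizing p {ν : Environment Bool Bool 1 | ∃ a, IsSeqPredDet ν a} := by
  intro hp
  obtain ⟨ν, ⟨a, ha⟩, h0⟩ := exists_isSeqPredDet_rew_eq_zero p
  have h1 := (ha.respondsWith.valueIs_iff p 1).1 (hp ν ⟨a, ha⟩ 1 (isOptimalValue_one ha))
  have h2 : avg (play (seqResponse a) p) = fun _ => 0 := by
    funext m
    simp [avg, ← ha.respondsWith.detZ_eq, h0]
  rw [h2] at h1
  exact zero_ne_one (tendsto_nhds_unique tendsto_const_nhds h1)

/-- **Uncountable classes of value-stable environments need not admit self-optimizing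
policies.**  The class of all deterministic passive sequence-prediction environments is
uncountable; every environment in it is value-stable (with `r_i ≡ 1`, `d ≡ 1`, `φ ≡ 0`,
so `V*_ν = 1`); and for every policy `p` there is an environment in the class on which
`p` receives reward `0` at every step; hence no self-optimizing policy for this class
exists. -/
theorem uncountable_valueStable_no_selfOptimizing :
    ¬ {ν : Environment Bool Bool 1 | ∃ a, IsSeqPredDet ν a}.Countable ∧
    (∀ ν ∈ {ν : Environment Bool Bool 1 | ∃ a, IsSeqPredDet ν a},
      ValueStableWith ν 1 (fun _ => 1) (fun _ _ => 1) (fun _ _ => 0)) ∧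
    (∀ p : Policy Bool Bool 1,
      ∃ ν ∈ {ν : Environment Bool Bool 1 | ∃ a, IsSeqPredDet ν a},
        ∀ i, rew (detZ ν p i) = 0) ∧
    ¬ ∃ p : Policy Bool Bool 1,
        SelfOptimizing p {ν : Environment Bool Bool 1 | ∃ a, IsSeqPredDet ν a} := by
  refine ⟨not_countable_isSeqPredDet, ?_, exists_isSeqPredDet_rew_eq_zero, ?_⟩
  · rintro ν ⟨a, ha⟩
    exact valueStableWith_one ha
  · rintro ⟨p, hp⟩
    exact not_selfOptimizing p hp

end RL
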